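/- Let m ≥ 3 be odd, let G(m) = ⟨x, y ∣ x² = yᵐ⟩ with Garside element Δ = x², and let φ be the automorphism with φ(x) = x⁻¹, φ(y) = y⁻¹. For every v ∈ G(m), every integer b, and all ε₁, ε₂ ∈ {1, −1}: y^{b} v x^{ε₁} Δ^{ε₂} ∼_φ y^{b} v x^{−ε₁}. (Rule (R5) is invariant under ∼_φ.) -/

import Mathlib

/-- The single relation `x² = yᵐ` of the torus knot group, over generators
indexed by `Bool` (`true ↦ x`, `false ↦ y`). -/
def torusRels (m : ℕ) : Set (FreeGroup Bool) :=
  {FreeGroup.of true ^ 2 * (FreeGroup.of false ^ m)⁻¹}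

/-- The torus knot group `⟨x, y ∣ x² = yᵐ⟩`. -/
abbrev TorusGrp (m : ℕ) : Type := PresentedGroup (torusRels m)

/-- The generator `x` of `⟨x, y ∣ x² = yᵐ⟩`. -/
def xg (m : ℕ) : TorusGrp m := PresentedGroup.of true

/-- The generator `y` of `⟨x, y ∣ x² = yᵐ⟩`. -/
def yg (m : ℕ) : TorusGrp m := PresentedGroup.of false

/-- The Garside element `Δ = x²` of `⟨x, y ∣ x² = yᵐ⟩`. -/
def Δg (m : ℕ) : TorusGrp m := xg m ^ 2

/-- `u` is `φ`-twisted conjugate to `v`: there is `w` with `v = φ(w)⁻¹ u w`. -/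
def twistedConj {G : Type*} [Group G] (φ : MulAut G) (u v : G) : Prop :=
  ∃ w : G, v = (φ w)⁻¹ * u * w

theorem xg_sq_eq_yg_pow (m : ℕ) : xg m ^ 2 = yg m ^ m := by
  have h : PresentedGroup.mk (torusRels m)
      (FreeGroup.of true ^ 2 * (FreeGroup.of false ^ m)⁻¹) = 1 :=
    PresentedGroup.one_of_mem rfl
  rw [map_mul, map_inv, map_pow, map_pow] at h
  exact mul_inv_eq_one.mp h

/-- The Garside element is central. -/
theorem commute_Δg (m : ℕ) (g : TorusGrp m) : Commute (Δg m) g := by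
  have h : (MulAut.conj (Δg m)).toMonoidHom = MonoidHom.id (TorusGrp m) := by
    refine PresentedGroup.ext fun t => ?_
    change Δg m * PresentedGroup.of t * (Δg m)⁻¹ = PresentedGroup.of t
    rw [mul_inv_eq_iff_eq_mul]
    cases t
    · change Δg m * yg m = yg m * Δg m
      rw [Δg, xg_sq_eq_yg_pow]
      exact (Commute.refl (yg m)).pow_left m
    · exact (Commute.refl (xg m)).pow_left 2
  have hg : Δg m * g * (Δg m)⁻¹ = g := DFunLike.congr_fun h g
  exact mul_inv_eq_iff_eq_mul.mp hg

/-- Rule (R5) is invariant under `∼_φ`: `y^{b} v x^{ε₁} Δ^{ε₂} ∼_φ y^{b} v x^{−ε₁}`. -/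
theorem twistedConj_R5 (m : ℕ) (hm : 3 ≤ m) (hodd : Odd m)
    (φ : MulAut (TorusGrp m)) (hφx : φ (xg m) = (xg m)⁻¹) (hφy : φ (yg m) = (yg m)⁻¹)
    (v : TorusGrp m) (b : ℤ) (ε₁ ε₂ : ℤ) (hε₁ : ε₁ = 1 ∨ ε₁ = -1) (hε₂ : ε₂ = 1 ∨ ε₂ = -1) :
    twistedConj φ (yg m ^ b * v * xg m ^ ε₁ * Δg m ^ ε₂) (yg m ^ b * v * xg m ^ (-ε₁)) := by
  have hΔ (k : ℤ) : Δg m ^ k = xg m ^ (2 * k) := by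
    rw [zpow_mul]; rfl
  have hsum : ε₁ = ε₂ ∨ ε₁ = -ε₂ := by omega
  rcases hsum with rfl | rfl
  · refine ⟨Δg m ^ (-ε₁), ?_⟩
    have hφΔ : (φ (Δg m ^ (-ε₁)))⁻¹ = Δg m ^ (-ε₁) := by
      simp [Δg, hφx]
    rw [hφΔ, ((commute_Δg m _).zpow_left (-ε₁)).eq]
    simp only [hΔ, mul_assoc, ← zpow_add]
    ring_nf
  · refine ⟨1, ?_⟩
    simp only [hΔ, map_one, inv_one, one_mul, mul_one, mul_assoc, ← zpow_add]
    ring_nf
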